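/- Let Ω ⊆ ℝ^m be open and θ : Ω → L(ℝ^m, ℝ³) smooth. For a smooth vector field X : Ω → ℝ^m and a smooth map φ : Ω → ℝ³ define (∇_X φ)(x) := Dφ(x)(X x) − θ x (X x) × φ x, and define the curvature vector ρ x (v,w) := −(Dθ(x)v)(w) + (Dθ(x)w)(v) + θ x v × θ x w. On pairs (X, φ) define the bracket ⟦(X,φ),(X',φ')⟧ := ( [X,X'] , x ↦ −ρ x (X x, X' x) + (∇_X φ')(x) − (∇_{X'} φ)(x) + φ' x × φ x ). Then this bracket satisfies the Jacobi identity: for any three smooth pairs (X₁,φ₁), (X₂,φ₂), (X₃,φ₃), the cyclic sum ⟦(X₁,φ₁),⟦(X₂,φ₂),(X₃,φ₃)⟧⟧ + ⟦(X₂,φ₂),⟦(X₃,φ₃),(X₁,φ₁)⟧⟧ + ⟦(X₃,φ₃),⟦(X₁,φ₁),(X₂,φ₂)⟧⟧ vanishes identically on Ω. -/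

import Mathlib

noncomputable section

/-- The curvature vector `ρ x (v, w) = −(Dθ(x)v)(w) + (Dθ(x)w)(v) + θ x v × θ x w`
of an `so(3)`-valued connection form `θ` written in vector form. -/
def rho3 {m : ℕ}
    (θ : EuclideanSpace ℝ (Fin m) → (EuclideanSpace ℝ (Fin m) →L[ℝ] (Fin 3 → ℝ)))
    (x v w : EuclideanSpace ℝ (Fin m)) : Fin 3 → ℝ :=
  -(fderiv ℝ θ x v w) + fderiv ℝ θ x w v + crossProduct (θ x v) (θ x w)

/-- The covariant derivative `(∇_X φ)(x) = Dφ(x)(X x) − θ x (X x) × φ x` of an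
`ℝ³`-valued map along a vector field. -/
def covd3 {m : ℕ}
    (θ : EuclideanSpace ℝ (Fin m) → (EuclideanSpace ℝ (Fin m) →L[ℝ] (Fin 3 → ℝ)))
    (X : EuclideanSpace ℝ (Fin m) → EuclideanSpace ℝ (Fin m))
    (φ : EuclideanSpace ℝ (Fin m) → (Fin 3 → ℝ))
    (x : EuclideanSpace ℝ (Fin m)) : Fin 3 → ℝ :=
  fderiv ℝ φ x (X x) - crossProduct (θ x (X x)) (φ x)

/-- The bracket `⟦(X, φ), (X', φ')⟧ = ([X, X'], −ρ(X, X') + ∇_X φ' − ∇_{X'} φ + φ' × φ)`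
on pairs consisting of a vector field and an `ℝ³`-valued coefficient. -/
def sbracket {m : ℕ}
    (θ : EuclideanSpace ℝ (Fin m) → (EuclideanSpace ℝ (Fin m) →L[ℝ] (Fin 3 → ℝ)))
    (P P' : (EuclideanSpace ℝ (Fin m) → EuclideanSpace ℝ (Fin m)) ×
      (EuclideanSpace ℝ (Fin m) → (Fin 3 → ℝ))) :
    (EuclideanSpace ℝ (Fin m) → EuclideanSpace ℝ (Fin m)) ×
      (EuclideanSpace ℝ (Fin m) → (Fin 3 → ℝ)) :=
  (fun x => fderiv ℝ P'.1 x (P.1 x) - fderiv ℝ P.1 x (P'.1 x),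
   fun x => -(rho3 θ x (P.1 x) (P'.1 x)) + covd3 θ P.1 P'.2 x - covd3 θ P'.1 P.2 x
     + crossProduct (P'.2 x) (P.2 x))

open VectorField Filter Topology

section FlatBracket

variable {E : Type*} [NormedAddCommGroup E] [NormedSpace ℝ E]

theorem hasFDerivAt_crossProduct {f g : E → (Fin 3 → ℝ)} {f' g' : E →L[ℝ] (Fin 3 → ℝ)} {x : E}
    (hf : HasFDerivAt f f' x) (hg : HasFDerivAt g g' x) :
    HasFDerivAt (fun y => crossProduct (f y) (g y))
      ((crossProduct (R := ℝ)).toContinuousBilinearMap.precompR E (f x) g' +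
        (crossProduct (R := ℝ)).toContinuousBilinearMap.precompL E f' (g x)) x :=
  (crossProduct (R := ℝ)).toContinuousBilinearMap.hasFDerivAt_of_bilinear hf hg

theorem DifferentiableAt.crossProduct {f g : E → (Fin 3 → ℝ)} {x : E}
    (hf : DifferentiableAt ℝ f x) (hg : DifferentiableAt ℝ g x) :
    DifferentiableAt ℝ (fun y => crossProduct (f y) (g y)) x :=
  (hasFDerivAt_crossProduct hf.hasFDerivAt hg.hasFDerivAt).differentiableAt

theorem fderiv_crossProduct_apply {f g : E → (Fin 3 → ℝ)} {x : E}
    (hf : DifferentiableAt ℝ f x) (hg : DifferentiableAt ℝ g x) (v : E) :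
    fderiv ℝ (fun y => crossProduct (f y) (g y)) x v =
      crossProduct (f x) (fderiv ℝ g x v) + crossProduct (fderiv ℝ f x v) (g x) := by
  rw [(hasFDerivAt_crossProduct hf.hasFDerivAt hg.hasFDerivAt).fderiv]
  rfl

/-- Both components of the pair `P` are `n` times continuously differentiable at `x`. -/
def PairContDiffAt (n : WithTop ℕ∞) (P : (E → E) × (E → (Fin 3 → ℝ))) (x : E) : Prop :=
  ContDiffAt ℝ n P.1 x ∧ ContDiffAt ℝ n P.2 x

/-- The bracket on pairs for the trivial connection. -/
def flatBracket (P Q : (E → E) × (E → (Fin 3 → ℝ))) : (E → E) × (E → (Fin 3 → ℝ)) :=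
  (lieBracket ℝ P.1 Q.1,
   fun x => fderiv ℝ Q.2 x (P.1 x) - fderiv ℝ P.2 x (Q.1 x) + crossProduct (Q.2 x) (P.2 x))

theorem ContDiffAt.differentiableAt_fderiv_apply {F : Type*} [NormedAddCommGroup F]
    [NormedSpace ℝ F] {f : E → F} {V : E → E} {x : E} (hf : ContDiffAt ℝ 2 f x)
    (hV : DifferentiableAt ℝ V x) : DifferentiableAt ℝ (fun y => fderiv ℝ f y (V y)) x :=
  ((hf.fderiv_right (m := 1) (by norm_num)).differentiableAt one_ne_zero).clm_apply hV

theorem PairContDiffAt.differentiableAt_fst {P : (E → E) × (E → (Fin 3 → ℝ))} {x : E}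
    (hP : PairContDiffAt 2 P x) : DifferentiableAt ℝ P.1 x :=
  hP.1.differentiableAt two_ne_zero

theorem PairContDiffAt.differentiableAt_snd {P : (E → E) × (E → (Fin 3 → ℝ))} {x : E}
    (hP : PairContDiffAt 2 P x) : DifferentiableAt ℝ P.2 x :=
  hP.2.differentiableAt two_ne_zero

theorem differentiableAt_flatBracket_fst {P Q : (E → E) × (E → (Fin 3 → ℝ))} {x : E}
    (hP : PairContDiffAt 2 P x) (hQ : PairContDiffAt 2 Q x) :
    DifferentiableAt ℝ (flatBracket P Q).1 x :=
  (hP.1.lieBracket_vectorField hQ.1 (m := 1) (by norm_num)).differentiableAt one_ne_zero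

theorem differentiableAt_flatBracket_snd {P Q : (E → E) × (E → (Fin 3 → ℝ))} {x : E}
    (hP : PairContDiffAt 2 P x) (hQ : PairContDiffAt 2 Q x) :
    DifferentiableAt ℝ (flatBracket P Q).2 x :=
  ((hQ.2.differentiableAt_fderiv_apply hP.differentiableAt_fst).sub
    (hP.2.differentiableAt_fderiv_apply hQ.differentiableAt_fst)).add
    (hQ.differentiableAt_snd.crossProduct hP.differentiableAt_snd)

theorem flatBracket_flatBracket_snd {P Q R : (E → E) × (E → (Fin 3 → ℝ))} {x : E}
    (hP : PairContDiffAt 2 P x) (hQ : PairContDiffAt 2 Q x) (hR : PairContDiffAt 2 R x) :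
    (flatBracket P (flatBracket Q R)).2 x =
      fderiv ℝ (fun y => fderiv ℝ R.2 y (Q.1 y)) x (P.1 x)
      - fderiv ℝ (fun y => fderiv ℝ Q.2 y (R.1 y)) x (P.1 x)
      + (crossProduct (R.2 x) (fderiv ℝ Q.2 x (P.1 x))
        + crossProduct (fderiv ℝ R.2 x (P.1 x)) (Q.2 x))
      - (fderiv ℝ (fun y => fderiv ℝ P.2 y (R.1 y)) x (Q.1 x)
        - fderiv ℝ (fun y => fderiv ℝ P.2 y (Q.1 y)) x (R.1 x))
      + crossProduct (fderiv ℝ R.2 x (Q.1 x) - fderiv ℝ Q.2 x (R.1 x)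
        + crossProduct (R.2 x) (Q.2 x)) (P.2 x) := by
  have hRQ := hR.2.differentiableAt_fderiv_apply hQ.differentiableAt_fst
  have hQR := hQ.2.differentiableAt_fderiv_apply hR.differentiableAt_fst
  have hc := hR.differentiableAt_snd.crossProduct hQ.differentiableAt_snd
  simp only [flatBracket]
  rw [fderiv_fun_add (hRQ.fun_sub hQR) hc, fderiv_fun_sub hRQ hQR,
    fderiv_apply_lieBracket (n := 2) hP.2 (by simp) hR.differentiableAt_fst
      hQ.differentiableAt_fst, add_apply, sub_apply,
    fderiv_crossProduct_apply hR.differentiableAt_snd hQ.differentiableAt_snd]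

theorem lieBracket_jacobi {U V W : E → E} {x : E} (hU : ContDiffAt ℝ 2 U x)
    (hV : ContDiffAt ℝ 2 V x) (hW : ContDiffAt ℝ 2 W x) :
    lieBracket ℝ U (lieBracket ℝ V W) x + lieBracket ℝ V (lieBracket ℝ W U) x
      + lieBracket ℝ W (lieBracket ℝ U V) x = 0 := by
  have hneg : lieBracket ℝ U W = -lieBracket ℝ W U := funext fun _ => lieBracket_swap
  rw [leibniz_identity_lieBracket (n := 2) (by simp) hU hV hW, hneg,
    lieBracket_swap (V := lieBracket ℝ U V)]
  have hneg' : lieBracket ℝ V (-lieBracket ℝ W U) x = -lieBracket ℝ V (lieBracket ℝ W U) x := by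
    simp [lieBracket, fderiv_neg, sub_eq_add_neg, add_comm]
  rw [hneg']
  abel

theorem flatBracket_jacobi_snd {P Q R : (E → E) × (E → (Fin 3 → ℝ))} {x : E}
    (hP : PairContDiffAt 2 P x) (hQ : PairContDiffAt 2 Q x) (hR : PairContDiffAt 2 R x) :
    (flatBracket P (flatBracket Q R)).2 x + (flatBracket Q (flatBracket R P)).2 x
      + (flatBracket R (flatBracket P Q)).2 x = 0 := by
  rw [flatBracket_flatBracket_snd hP hQ hR, flatBracket_flatBracket_snd hQ hR hP,
    flatBracket_flatBracket_snd hR hP hQ]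
  ext i
  fin_cases i <;> simp [cross_apply, Matrix.vecHead, Matrix.vecTail] <;> ring

theorem flatBracket_snd_congr_right {P Q Q' : (E → E) × (E → (Fin 3 → ℝ))} {x : E}
    (h₁ : Q.1 =ᶠ[𝓝 x] Q'.1) (h₂ : Q.2 =ᶠ[𝓝 x] Q'.2) :
    (flatBracket P Q).2 x = (flatBracket P Q').2 x := by
  simp only [flatBracket, h₁.eq_of_nhds, h₂.eq_of_nhds, h₂.fderiv_eq]

end FlatBracket

section Gauge

variable {m : ℕ}
  {θ : EuclideanSpace ℝ (Fin m) → (EuclideanSpace ℝ (Fin m) →L[ℝ] (Fin 3 → ℝ))}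
  {P Q R : (EuclideanSpace ℝ (Fin m) → EuclideanSpace ℝ (Fin m)) ×
    (EuclideanSpace ℝ (Fin m) → (Fin 3 → ℝ))}
  {x : EuclideanSpace ℝ (Fin m)}

/-- The shear `(X, φ) ↦ (X, φ + θ X)`, which intertwines `sbracket θ` with `flatBracket`. -/
def shear (θ : EuclideanSpace ℝ (Fin m) → (EuclideanSpace ℝ (Fin m) →L[ℝ] (Fin 3 → ℝ)))
    (P : (EuclideanSpace ℝ (Fin m) → EuclideanSpace ℝ (Fin m)) ×
      (EuclideanSpace ℝ (Fin m) → (Fin 3 → ℝ))) :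
    (EuclideanSpace ℝ (Fin m) → EuclideanSpace ℝ (Fin m)) ×
      (EuclideanSpace ℝ (Fin m) → (Fin 3 → ℝ)) :=
  (P.1, fun x => P.2 x + θ x (P.1 x))

theorem PairContDiffAt.shear {n : WithTop ℕ∞} (hθ : ContDiffAt ℝ n θ x)
    (hP : PairContDiffAt n P x) : PairContDiffAt n (shear θ P) x :=
  ⟨hP.1, hP.2.add (hθ.clm_apply hP.1)⟩

theorem shear_sbracket_snd (hθ : DifferentiableAt ℝ θ x)
    (hP₁ : DifferentiableAt ℝ P.1 x) (hP₂ : DifferentiableAt ℝ P.2 x)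
    (hQ₁ : DifferentiableAt ℝ Q.1 x) (hQ₂ : DifferentiableAt ℝ Q.2 x) :
    (shear θ (sbracket θ P Q)).2 x = (flatBracket (shear θ P) (shear θ Q)).2 x := by
  simp only [shear, sbracket, flatBracket, rho3, covd3]
  rw [fderiv_fun_add hQ₂ (hθ.clm_apply hQ₁), fderiv_fun_add hP₂ (hθ.clm_apply hP₁),
    fderiv_clm_apply hθ hQ₁, fderiv_clm_apply hθ hP₁]
  ext i
  fin_cases i <;> simp [cross_apply, Matrix.vecHead, Matrix.vecTail] <;> ring

theorem shear_sbracket_sbracket_snd (hθ : ContDiffAt ℝ 2 θ x)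
    (hP : PairContDiffAt 2 P x) (hQ : PairContDiffAt 2 Q x) (hR : PairContDiffAt 2 R x) :
    (shear θ (sbracket θ P (sbracket θ Q R))).2 x =
      (flatBracket (shear θ P) (flatBracket (shear θ Q) (shear θ R))).2 x := by
  have hdiff {F : Type} [NormedAddCommGroup F] [NormedSpace ℝ F]
      {f : EuclideanSpace ℝ (Fin m) → F} (hf : ContDiffAt ℝ 2 f x) :
      ∀ᶠ y in 𝓝 x, DifferentiableAt ℝ f y :=
    (hf.eventually (by simp)).mono fun _ hy => hy.differentiableAt two_ne_zero
  have heq : (shear θ (sbracket θ Q R)).2 =ᶠ[𝓝 x] (flatBracket (shear θ Q) (shear θ R)).2 := by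
    filter_upwards [hdiff hθ, hdiff hQ.1, hdiff hQ.2, hdiff hR.1, hdiff hR.2] with y h h₁ h₂ h₃ h₄
    exact shear_sbracket_snd h h₁ h₂ h₃ h₄
  have hθ' := hθ.differentiableAt two_ne_zero
  have hfst : DifferentiableAt ℝ (sbracket θ Q R).1 x := differentiableAt_flatBracket_fst hQ hR
  have hsnd : DifferentiableAt ℝ (sbracket θ Q R).2 x := by
    have hs := heq.differentiableAt_iff.2
      (differentiableAt_flatBracket_snd (hQ.shear hθ) (hR.shear hθ))
    simpa [shear] using hs.fun_sub (hθ'.clm_apply hfst)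
  rw [shear_sbracket_snd hθ' hP.differentiableAt_fst hP.differentiableAt_snd hfst hsnd]
  exact flatBracket_snd_congr_right EventuallyEq.rfl heq

end Gauge

/-- The bracket `⟦·,·⟧` on pairs `(X, φ)` satisfies the Jacobi identity on `Ω`. -/
theorem sbracket_jacobi {m : ℕ}
    (Ω : Set (EuclideanSpace ℝ (Fin m))) (hΩ : IsOpen Ω)
    (θ : EuclideanSpace ℝ (Fin m) → (EuclideanSpace ℝ (Fin m) →L[ℝ] (Fin 3 → ℝ)))
    (hθ : ContDiffOn ℝ (⊤ : ℕ∞) θ Ω)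
    (P₁ P₂ P₃ : (EuclideanSpace ℝ (Fin m) → EuclideanSpace ℝ (Fin m)) ×
      (EuclideanSpace ℝ (Fin m) → (Fin 3 → ℝ)))
    (h₁X : ContDiffOn ℝ (⊤ : ℕ∞) P₁.1 Ω) (h₁φ : ContDiffOn ℝ (⊤ : ℕ∞) P₁.2 Ω)
    (h₂X : ContDiffOn ℝ (⊤ : ℕ∞) P₂.1 Ω) (h₂φ : ContDiffOn ℝ (⊤ : ℕ∞) P₂.2 Ω)
    (h₃X : ContDiffOn ℝ (⊤ : ℕ∞) P₃.1 Ω) (h₃φ : ContDiffOn ℝ (⊤ : ℕ∞) P₃.2 Ω) :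
    ∀ x ∈ Ω,
      (sbracket θ P₁ (sbracket θ P₂ P₃)).1 x
        + (sbracket θ P₂ (sbracket θ P₃ P₁)).1 x
        + (sbracket θ P₃ (sbracket θ P₁ P₂)).1 x = 0
      ∧ (sbracket θ P₁ (sbracket θ P₂ P₃)).2 x
        + (sbracket θ P₂ (sbracket θ P₃ P₁)).2 x
        + (sbracket θ P₃ (sbracket θ P₁ P₂)).2 x = 0 := by
  intro x hx
  have hat {F : Type} [NormedAddCommGroup F] [NormedSpace ℝ F]
      {f : EuclideanSpace ℝ (Fin m) → F} (hf : ContDiffOn ℝ (⊤ : ℕ∞) f Ω) : ContDiffAt ℝ 2 f x :=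
    (hf.contDiffAt (hΩ.mem_nhds hx)).of_le (WithTop.coe_le_coe.2 (le_top : (2 : ℕ∞) ≤ ⊤))
  have hθx := hat hθ
  have h₁ : PairContDiffAt 2 P₁ x := ⟨hat h₁X, hat h₁φ⟩
  have h₂ : PairContDiffAt 2 P₂ x := ⟨hat h₂X, hat h₂φ⟩
  have h₃ : PairContDiffAt 2 P₃ x := ⟨hat h₃X, hat h₃φ⟩
  have hfst : (sbracket θ P₁ (sbracket θ P₂ P₃)).1 x + (sbracket θ P₂ (sbracket θ P₃ P₁)).1 x
      + (sbracket θ P₃ (sbracket θ P₁ P₂)).1 x = 0 := lieBracket_jacobi h₁.1 h₂.1 h₃.1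
  refine ⟨hfst, ?_⟩
  have hsnd := flatBracket_jacobi_snd (h₁.shear hθx) (h₂.shear hθx) (h₃.shear hθx)
  rw [← shear_sbracket_sbracket_snd hθx h₁ h₂ h₃, ← shear_sbracket_sbracket_snd hθx h₂ h₃ h₁,
    ← shear_sbracket_sbracket_snd hθx h₃ h₁ h₂] at hsnd
  simp only [shear] at hsnd
  have hθ₀ := congrArg (θ x) hfst
  rw [map_add, map_add, map_zero] at hθ₀
  rw [← hsnd, ← sub_eq_zero, ← neg_eq_zero, ← hθ₀]
  abel
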